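/- arXiv:1509.03748 — 2 statements merged into one kernel-verified Lean document; each statement's English description precedes it below -/
import Mathlib

section
/- Let X be a metric space with a constant-speed bicombing γ that is A-convex, where A is monotonically increasing in its second and third arguments and, in its first argument, monotonically increasing on [0,1/3] and monotonically decreasing on [2/3,1], and suppose there is a monotonically increasing continuous f : [0,∞) → [0,∞) with f(0) = 0 and |l(γ_{x,y}) − l(γ_{x',y'})| ≤ f(d(x,x') + d(y,y')). Let r', L, β > 0, r'' > f(β), and x₁, x₂ ∈ X with d(x₁,x₂) ≤ β and r''/(r'' + 2r' + f(β) + L) ≥ 2/3. Let r ≥ r'' + 2r' + f(β), T := r − r' − f(β), x ∈ P_{r+L}(x₁), and τ := l(c_{x₂,x}) − l(c_{x₁,x}). Then for all t ∈ [T − r', T + r'] one has d_X(c_{x₁,x}(t), c_{x₂,x}(t+τ)) ≤ A(r''/(r'' + 2r' + f(β) + L), β, 0) + f(β)·(2r' + f(β) + L)/r''. -/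
open MeasureTheory Set

namespace FJ

/-- A constant-speed bicombing on a metric space `X`: a continuous map
`γ : X × X × [0,1] → X` such that each `γ_{x,y} := γ(x,y,·)` is a rectifiable path from `x`
to `y` of constant speed equal to its length `len x y`. -/
structure ConstSpeedBicombing (X : Type*) [MetricSpace X] where
  toFun : X → X → ℝ → X
  len : X → X → ℝ
  len_nonneg : ∀ x y, 0 ≤ len x y
  continuousOn : ContinuousOn (fun p : X × X × ℝ => toFun p.1 p.2.1 p.2.2)
      (Set.univ ×ˢ Set.univ ×ˢ Set.Icc (0:ℝ) 1)
  source : ∀ x y, toFun x y 0 = x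
  target : ∀ x y, toFun x y 1 = y
  speed : ∀ (x y : X) (s t : ℝ), 0 ≤ s → s ≤ t → t ≤ 1 →
      eVariationOn (toFun x y) (Set.Icc s t) = ENNReal.ofReal (len x y * (t - s))

/-- The trail `c_{x,y} : ℝ → X` associated to a bicombing: constant `x` on `(-∞,0]`,
the path `γ_{x,y}` parametrised by arclength on `[0, len x y]`, constant `y` on
`[len x y, ∞)`. -/
noncomputable def trail {X : Type*} [MetricSpace X] (B : ConstSpeedBicombing X)
    (x y : X) : ℝ → X :=
  fun t => if t ≤ 0 then x else if t < B.len x y then B.toFun x y (t / B.len x y) else y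

/-- The shift `Φ_τ(f) = f(· + τ)`. -/
def timeShift {X : Type*} (τ : ℝ) (f : ℝ → X) : ℝ → X := fun t => f (t + τ)

/-- The metric `D` on `Lip₁(X)`: `D(f,g) = ∫_ℝ d(f t, g t) / (2 e^{|t|}) dt`. -/
noncomputable def lipDist {X : Type*} [MetricSpace X] (f g : ℝ → X) : ℝ :=
  ∫ t : ℝ, dist (f t) (g t) / (2 * Real.exp |t|)

/-- `A(X,γ) = {Φ_τ c_{x,y} | τ ∈ ℝ, x, y ∈ X}`, as a subset of `C(ℝ, X)` (whose
compact-open topology induces on `Lip₁(X)` the topology of the metric `D`). -/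
def ASet {X : Type*} [MetricSpace X] (B : ConstSpeedBicombing X) : Set C(ℝ, X) :=
  {w | ∃ (x y : X) (τ : ℝ), ∀ s, w s = trail B x y (s + τ)}

/-- The flow space `FS(X,γ)`, the closure of `A(X,γ)`. -/
def FSSet {X : Type*} [MetricSpace X] (B : ConstSpeedBicombing X) : Set C(ℝ, X) :=
  closure (ASet B)

/-- The restriction `res_{[a,b]}(w)`: equal to `w a` on `(-∞,a]`, to `w` on `[a,b]`,
and to `w b` on `[b,∞)`. -/
noncomputable def trailRes {X : Type*} (a b : ℝ) (w : ℝ → X) : ℝ → X :=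
  fun t => if t ≤ a then w a else if t ≤ b then w t else w b

/-- `A(X,γ,[a,b]) = A(X,γ) ∩ Lip₁(X,[a,b])`: the elements of `A(X,γ)` which are constant
on `(-∞,a]` and on `[b,∞)`. -/
def AIntSet {X : Type*} [MetricSpace X] (B : ConstSpeedBicombing X) (a b : ℝ) :
    Set C(ℝ, X) :=
  {w | w ∈ ASet B ∧ (∀ s, s ≤ a → w s = w a) ∧ (∀ s, b ≤ s → w s = w b)}

/-- A bicombing is consistent if the chosen paths behave well under restriction. -/
def BicombingConsistent {X : Type*} [MetricSpace X] (B : ConstSpeedBicombing X) : Prop :=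
  ∀ (x y : X) (s s' t : ℝ), 0 ≤ s → s < s' → s' ≤ 1 → s ≤ t → t ≤ s' →
    B.toFun x y t = B.toFun (B.toFun x y s) (B.toFun x y s') ((t - s) / (s' - s))

/-- A bicombing is `A`-convex if `d(γ_{x,y}(t), γ_{x',y'}(t)) ≤ A(t, d(x,x'), d(y,y'))`. -/
def BicombingAConvex {X : Type*} [MetricSpace X] (B : ConstSpeedBicombing X)
    (A : ℝ → ℝ → ℝ → ℝ) : Prop :=
  ∀ (x x' y y' : X) (t : ℝ), 0 ≤ t → t ≤ 1 →
    dist (B.toFun x y t) (B.toFun x' y' t) ≤ A t (dist x x') (dist y y')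

/-- The conditions on the comparison function `A` of an `A`-convex bicombing:
`A : [0,1] × [0,∞) × [0,∞) → [0,∞)` is continuous with `A(1,s,0) = A(0,0,s) = 0`. -/
def ConvexityFun (A : ℝ → ℝ → ℝ → ℝ) : Prop :=
  ContinuousOn (fun p : ℝ × ℝ × ℝ => A p.1 p.2.1 p.2.2)
      (Set.Icc (0:ℝ) 1 ×ˢ Set.Ici (0:ℝ) ×ˢ Set.Ici (0:ℝ)) ∧
  (∀ t s s', 0 ≤ t → t ≤ 1 → 0 ≤ s → 0 ≤ s' → 0 ≤ A t s s') ∧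
  (∀ s, 0 ≤ s → A 1 s 0 = 0) ∧ (∀ s, 0 ≤ s → A 0 0 s = 0)

/-- The monotonicity conditions on `A`: monotonically increasing in the second and third
arguments and, in the first argument, monotonically increasing on `[0,1/3]` and
monotonically decreasing on `[2/3,1]`. -/
def MonotoneConvexityFun (A : ℝ → ℝ → ℝ → ℝ) : Prop :=
  (∀ t s₁ s₂ s', 0 ≤ t → t ≤ 1 → 0 ≤ s₁ → s₁ ≤ s₂ → 0 ≤ s' → A t s₁ s' ≤ A t s₂ s') ∧
  (∀ t s s₁ s₂, 0 ≤ t → t ≤ 1 → 0 ≤ s → 0 ≤ s₁ → s₁ ≤ s₂ → A t s s₁ ≤ A t s s₂) ∧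
  (∀ t₁ t₂ s s', 0 ≤ t₁ → t₁ ≤ t₂ → t₂ ≤ 1/3 → 0 ≤ s → 0 ≤ s' → A t₁ s s' ≤ A t₂ s s') ∧
  (∀ t₁ t₂ s s', 2/3 ≤ t₁ → t₁ ≤ t₂ → t₂ ≤ 1 → 0 ≤ s → 0 ≤ s' → A t₂ s s' ≤ A t₁ s s')

/-- The paths of a constant-speed bicombing are Lipschitz with constant their length. -/
lemma ConstSpeedBicombing.dist_toFun_le {X : Type*} [MetricSpace X] (B : ConstSpeedBicombing X)
    (x y : X) {s t : ℝ} (hs : s ∈ Icc (0 : ℝ) 1) (ht : t ∈ Icc (0 : ℝ) 1) :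
    dist (B.toFun x y s) (B.toFun x y t) ≤ B.len x y * |s - t| := by
  wlog hst : s ≤ t generalizing s t
  · rw [dist_comm, abs_sub_comm]
    exact this ht hs (le_of_not_ge hst)
  have h := eVariationOn.edist_le (B.toFun x y) (left_mem_Icc.2 hst) (right_mem_Icc.2 hst)
  rw [B.speed x y s t hs.1 hst ht.2, edist_dist] at h
  rw [abs_sub_comm, abs_of_nonneg (sub_nonneg.2 hst)]
  exact (ENNReal.ofReal_le_ofReal_iff
    (mul_nonneg (B.len_nonneg x y) (sub_nonneg.2 hst))).1 h

lemma trail_of_pos_of_lt {X : Type*} [MetricSpace X] (B : ConstSpeedBicombing X) {x y : X}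
    {t : ℝ} (h₀ : 0 < t) (h₁ : t < B.len x y) :
    trail B x y t = B.toFun x y (t / B.len x y) := by
  rw [trail, if_neg h₀.not_ge, if_pos h₁]

lemma trail_of_pos_of_le {X : Type*} [MetricSpace X] (B : ConstSpeedBicombing X) {x y : X}
    {t : ℝ} (h₀ : 0 < t) (h₁ : B.len x y ≤ t) : trail B x y t = y := by
  rw [trail, if_neg h₀.not_ge, if_neg h₁.not_gt]

/-- Lemma 3.6: with the standing assumptions (an `A`-convex bicombing with `A` monotone as
in the remark, and a monotone continuous length control function `f`), given
`r', L, β > 0`, `r'' > f(β)`, points `x₁, x₂` with `d(x₁,x₂) ≤ β`,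
`r''/(r'' + 2r' + f(β) + L) ≥ 2/3`, `r ≥ r'' + 2r' + f(β)`, `T = r − r' − f(β)`,
`x ∈ P_{r+L}(x₁)` and `τ = l(c_{x₂,x}) − l(c_{x₁,x})`, we have, for all
`t ∈ [T − r', T + r']`:
`d(c_{x₁,x}(t), c_{x₂,x}(t+τ)) ≤ A(r''/(r''+2r'+f(β)+L), β, 0) + f(β)(2r'+f(β)+L)/r''`. -/
theorem trails_close_for_long_time {X : Type*} [MetricSpace X]
    (B : ConstSpeedBicombing X)
    {A : ℝ → ℝ → ℝ → ℝ} (hA : ConvexityFun A) (hAmon : MonotoneConvexityFun A)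
    (hconv : BicombingAConvex B A)
    (f : ℝ → ℝ) (hfc : ContinuousOn f (Set.Ici 0)) (hf0 : f 0 = 0)
    (hfnn : ∀ s, 0 ≤ s → 0 ≤ f s)
    (hfmono : ∀ s t : ℝ, 0 ≤ s → s ≤ t → f s ≤ f t)
    (hlen : ∀ x x' y y' : X, |B.len x y - B.len x' y'| ≤ f (dist x x' + dist y y'))
    (r' L β r'' : ℝ) (hr' : 0 < r') (hL : 0 < L) (hβ : 0 < β) (hr'' : f β < r'')
    (x₁ x₂ : X) (hx₁₂ : dist x₁ x₂ ≤ β)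
    (hfrac : 2/3 ≤ r'' / (r'' + 2*r' + f β + L))
    (r : ℝ) (hr : r'' + 2*r' + f β ≤ r)
    (T : ℝ) (hT : T = r - r' - f β)
    (x : X) (hx : B.len x₁ x ≤ r + L)
    (τ : ℝ) (hτ : τ = B.len x₂ x - B.len x₁ x) :
    ∀ t : ℝ, T - r' ≤ t → t ≤ T + r' →
      dist (trail B x₁ x t) (trail B x₂ x (t + τ)) ≤
        A (r'' / (r'' + 2*r' + f β + L)) β 0 + f β * (2*r' + f β + L) / r'' := by
  intro t ht₁ ht₂
  obtain ⟨-, hAnn, -, -⟩ := hA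
  obtain ⟨hA₂, -, -, hA₁⟩ := hAmon
  have hφ : 0 ≤ f β := hfnn β hβ.le
  have hr''0 : 0 < r'' := hφ.trans_lt hr''
  have hab : |τ| ≤ f β := by
    have h := hlen x₂ x₁ x x
    rw [dist_self, add_zero, dist_comm, ← hτ] at h
    exact h.trans (hfmono _ _ dist_nonneg hx₁₂)
  have ht : r'' ≤ t := by linarith
  have ht0 : 0 < t := hr''0.trans_le ht
  have htτ : 0 < t + τ := by linarith [neg_abs_le τ]
  have hC : 0 < 2 * r' + f β + L := by linarith
  have hq1 : r'' / (r'' + 2 * r' + f β + L) ≤ 1 := div_le_one_of_le₀ (by linarith) (by linarith)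
  rcases le_or_gt (B.len x₁ x) t with hat | hta
  · rw [trail_of_pos_of_le B ht0 hat, trail_of_pos_of_le B htτ (by linarith), dist_self]
    have := hAnn (r'' / (r'' + 2 * r' + f β + L)) β 0 (by linarith) hq1 hβ.le le_rfl
    positivity
  have htb : t + τ < B.len x₂ x := by linarith
  rw [trail_of_pos_of_lt B ht0 hta, trail_of_pos_of_lt B htτ htb]
  generalize ha : B.len x₁ x = a at *
  generalize hb : B.len x₂ x = b at *
  have ha0 : 0 < a := ht0.trans hta
  have hb0 : 0 < b := htτ.trans htb
  have hs0 : 0 ≤ t / a := by positivity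
  have hs1 : t / a ≤ 1 := div_le_one_of_le₀ hta.le ha0.le
  have hqs : r'' / (r'' + 2 * r' + f β + L) ≤ t / a := by
    rw [div_le_div_iff₀ (by linarith) ha0]
    nlinarith
  refine (dist_triangle _ (B.toFun x₂ x (t / a)) _).trans (add_le_add ?_ ?_)
  · have h := hconv x₁ x₂ x x (t / a) hs0 hs1
    rw [dist_self] at h
    exact h.trans ((hA₂ _ _ _ _ hs0 hs1 dist_nonneg hx₁₂ le_rfl).trans
      (hA₁ _ _ _ _ hfrac hqs hs1 hβ.le le_rfl))
  · have h := B.dist_toFun_le x₂ x (s := t / a) (t := (t + τ) / b) ⟨hs0, hs1⟩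
      ⟨by positivity, div_le_one_of_le₀ htb.le hb0.le⟩
    have heq : b * |t / a - (t + τ) / b| = |τ| * (a - t) / a := by
      have h' : b * (t / a - (t + τ) / b) = -τ * (a - t) / a := by
        subst hτ
        field_simp
        ring
      rw [← abs_of_pos hb0, ← abs_mul, abs_of_pos hb0, h', abs_div, abs_mul, abs_neg,
        abs_of_pos ha0, abs_of_pos (sub_pos.2 hta)]
    rw [hb, heq] at h
    refine h.trans (div_le_div₀ (by positivity) ?_ hr''0 (ht.trans hta.le))
    exact mul_le_mul hab (by linarith) (sub_nonneg.2 hta.le) hφ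
end FJ
end

section
/- Let X be a proper metric space with a consistent constant-speed bicombing γ satisfying γ_{x,x}(t) = x for all x, t, and suppose there is a continuous f : [0,∞) → [0,∞) with f(0) = 0 and |l(γ_{x,y}) − l(γ_{x',y'})| ≤ f(d(x,x') + d(y,y')) for all x,x',y,y'. Then for every x ∈ X and R > 0 the set P_R(x) = {y ∈ X : l(γ_{x,y}) ≤ R} is compact, contractible, and a neighborhood of x in X; a contraction is given by (y,t) ↦ γ_{x,y}(t), which takes values in P_R(x) for all y ∈ P_R(x) and t ∈ [0,1]. -/
open MeasureTheory Set

namespace FJ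

namespace ConstSpeedBicombing

variable {X : Type*} [MetricSpace X] (B : ConstSpeedBicombing X)

/-- The length of `γ_{x,y}` as a variation over the whole unit interval. -/
theorem eVariationOn_unit (x y : X) :
    eVariationOn (B.toFun x y) (Set.Icc 0 1) = ENNReal.ofReal (B.len x y) := by
  simpa using B.speed x y 0 1 le_rfl zero_le_one le_rfl

theorem dist_le_len (x y : X) : dist x y ≤ B.len x y := by
  have h := eVariationOn.edist_le (B.toFun x y) (s := Set.Icc (0:ℝ) 1) (x := 0) (y := 1)
    (by simp) (by simp)
  rwa [B.source, B.target, B.eVariationOn_unit, edist_dist,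
    ENNReal.ofReal_le_ofReal_iff (B.len_nonneg x y)] at h

theorem len_self (hdiag : ∀ (x : X) (t : ℝ), 0 ≤ t → t ≤ 1 → B.toFun x x t = x) (x : X) :
    B.len x x = 0 := by
  have h := B.eVariationOn_unit x x
  have h0 : eVariationOn (B.toFun x x) (Set.Icc 0 1) = 0 := by
    apply eVariationOn.constant_on
    rintro _ ⟨s, hs, rfl⟩ _ ⟨t, ht, rfl⟩
    rw [hdiag x s hs.1 hs.2, hdiag x t ht.1 ht.2]
  rw [h0, eq_comm, ENNReal.ofReal_eq_zero] at h
  exact le_antisymm h (B.len_nonneg x x)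

theorem len_toFun_le (hcons : BicombingConsistent B)
    (hdiag : ∀ (x : X) (t : ℝ), 0 ≤ t → t ≤ 1 → B.toFun x x t = x)
    (x y : X) {t : ℝ} (ht0 : 0 ≤ t) (ht1 : t ≤ 1) :
    B.len x (B.toFun x y t) ≤ B.len x y := by
  rcases ht0.eq_or_lt with rfl | ht
  · rw [B.source, B.len_self hdiag]
    exact B.len_nonneg x y
  have heq : Set.EqOn (B.toFun x (B.toFun x y t)) (B.toFun x y ∘ fun v => v * t)
      (Set.Icc 0 1) := by
    intro v hv
    have h := hcons x y 0 t (v * t) le_rfl ht ht1 (mul_nonneg hv.1 ht0)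
      (mul_le_of_le_one_left ht0 hv.2)
    rw [B.source, sub_zero, sub_zero, mul_div_cancel_right₀ _ ht.ne'] at h
    exact h.symm
  have hle := eVariationOn.comp_le_of_monotoneOn (B.toFun x y) (s := Set.Icc (0:ℝ) 1)
    (t := Set.Icc (0:ℝ) 1) (fun v => v * t)
    (fun a _ b _ hab => mul_le_mul_of_nonneg_right hab ht0)
    (fun v hv => ⟨mul_nonneg hv.1 ht0, mul_le_one₀ hv.2 ht0 ht1⟩)
  rwa [← eVariationOn.congr heq, B.eVariationOn_unit, B.eVariationOn_unit,
    ENNReal.ofReal_le_ofReal_iff (B.len_nonneg x y)] at hle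

/-- A modulus of continuity for lengths makes the length continuous in the endpoint. -/
theorem continuous_len_right {f : ℝ → ℝ} (hfc : ContinuousOn f (Set.Ici 0)) (hf0 : f 0 = 0)
    (hlen : ∀ x x' y y' : X, |B.len x y - B.len x' y'| ≤ f (dist x x' + dist y y')) (x : X) :
    Continuous (B.len x) := by
  rw [continuous_iff_continuousAt]
  intro y
  have hf : Continuous fun z : X => f (dist z y) :=
    hfc.comp_continuous (by fun_prop) fun z => dist_nonneg
  have h0 : Filter.Tendsto (fun z : X => f (dist z y)) (nhds y) (nhds 0) := by
    simpa [hf0] using hf.tendsto y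
  rw [ContinuousAt, tendsto_iff_dist_tendsto_zero]
  refine squeeze_zero (fun _ => dist_nonneg) (fun z => ?_) h0
  simpa [Real.dist_eq] using hlen x x z y

end ConstSpeedBicombing

/-- For a proper metric space `X` with a consistent constant-speed bicombing satisfying
`γ_{x,x}(t) = x` and with length control function `f`: for every `x ∈ X` and `R > 0` the
set `P_R(x) = {y | l(γ_{x,y}) ≤ R}` is compact, contractible and a neighborhood of `x`;
a contraction is given by `(y,t) ↦ γ_{x,y}(t)`, which takes values in `P_R(x)` for
`y ∈ P_R(x)`, `t ∈ [0,1]`. -/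
theorem pSet_compact_contractible_nbhd {X : Type*} [MetricSpace X] [ProperSpace X]
    (B : ConstSpeedBicombing X) (hcons : BicombingConsistent B)
    (hdiag : ∀ (x : X) (t : ℝ), 0 ≤ t → t ≤ 1 → B.toFun x x t = x)
    (f : ℝ → ℝ) (hfc : ContinuousOn f (Set.Ici 0)) (hf0 : f 0 = 0)
    (hfnn : ∀ s, 0 ≤ s → 0 ≤ f s)
    (hlen : ∀ x x' y y' : X, |B.len x y - B.len x' y'| ≤ f (dist x x' + dist y y'))
    (x : X) (R : ℝ) (hR : 0 < R) :
    IsCompact {y : X | B.len x y ≤ R} ∧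
    {y : X | B.len x y ≤ R} ∈ nhds x ∧
    (∀ y : X, B.len x y ≤ R → ∀ t : ℝ, 0 ≤ t → t ≤ 1 →
      B.len x (B.toFun x y t) ≤ R) ∧
    ContractibleSpace {y : X // B.len x y ≤ R} := by
  have hcont := B.continuous_len_right hfc hf0 hlen x
  have hmaps : ∀ y : X, B.len x y ≤ R → ∀ t : ℝ, 0 ≤ t → t ≤ 1 →
      B.len x (B.toFun x y t) ≤ R :=
    fun y hy t ht0 ht1 => (B.len_toFun_le hcons hdiag x y ht0 ht1).trans hy
  refine ⟨?_, ?_, hmaps, ?_⟩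
  · refine (isCompact_closedBall x R).of_isClosed_subset
      (isClosed_le hcont continuous_const) fun y hy => ?_
    rw [Metric.mem_closedBall, dist_comm]
    exact (B.dist_le_len x y).trans hy
  · refine hcont.continuousAt.eventually_le_const ?_
    rwa [B.len_self hdiag]
  · rw [contractible_iff_id_nullhomotopic]
    refine ⟨⟨x, (B.len_self hdiag x).trans_le hR.le⟩, ContinuousMap.Homotopic.symm ⟨?_⟩⟩
    exact
      { toFun := fun p => ⟨B.toFun x p.2 p.1, hmaps p.2 p.2.2 p.1 p.1.2.1 p.1.2.2⟩
        continuous_toFun := by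
          refine Continuous.subtype_mk ?_ _
          exact B.continuousOn.comp_continuous
            (f := fun p : unitInterval × {y : X // B.len x y ≤ R} =>
              (x, (p.2 : X), (p.1 : ℝ)))
            (by fun_prop) fun p => ⟨trivial, trivial, p.1.2⟩
        map_zero_left := fun y => Subtype.ext (B.source x y)
        map_one_left := fun y => Subtype.ext (B.target x y) }
end FJ
end
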